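/- arXiv:1611.04903 — 2 statements merged into one kernel-verified Lean document; each statement's English description precedes it below -/
import Mathlib

section
/- Let A, B be integers with |A| ≤ B and B ≥ 2, and let M be the 2×2 real matrix with rows (0, −B) and (1, −A). Let T be the unique nonempty compact subset of ℝ² satisfying M·T + ((B−1)/2, 0) = (⋃_{i=0}^{B−2} (T + (i,0))) ∪ (−T), and let T^ℓ be the unique nonempty compact subset of ℝ² satisfying M·T^ℓ = ⋃_{i=0}^{B−1} (T^ℓ + (i,0)). Then the matrix M − I₂ is invertible and T^ℓ = (T ∪ (−T)) + (M − I₂)⁻¹·((B−1)/2, 0), i.e. T^ℓ is the translate of T ∪ (−T) by the vector (M − I₂)⁻¹·((B−1)/2, 0). -/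
open Set Pointwise

noncomputable section

/-- The plane. -/
abbrev Pt : Type := Fin 2 → ℝ

/-- A planar set is disk-like if it is homeomorphic to the closed unit (Euclidean) disk. -/
def DiskLike (S : Set Pt) : Prop :=
  Nonempty (↥S ≃ₜ ↥(Metric.closedBall (0 : EuclideanSpace ℝ (Fin 2)) 1))

/-- The set equation `M T + ((B-1)/2, 0) = (⋃_{i=0}^{B-2} (T + (i,0))) ∪ (-T)`
for `M = !![0, -B; 1, -A]`. -/
def CrysEq (A B : ℤ) (T : Set Pt) : Prop :=
  (fun x => (!![0, -(B:ℝ); 1, -(A:ℝ)]).mulVec x + ![((B:ℝ)-1)/2, 0]) '' T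
    = (⋃ i ∈ Finset.Icc (0:ℤ) (B-2), (fun x => x + ![(i:ℝ), 0]) '' T) ∪ (-T)

/-- The set equation `M L = ⋃_{i=0}^{B-1} (L + (i,0))` for `M = !![0, -B; 1, -A]`. -/
def LatEq (A B : ℤ) (L : Set Pt) : Prop :=
  (fun x => (!![0, -(B:ℝ); 1, -(A:ℝ)]).mulVec x) '' L
    = ⋃ i ∈ Finset.Icc (0:ℤ) (B-1), (fun x => x + ![(i:ℝ), 0]) '' L

/-- Membership in the crystallographic group p2: maps `x ↦ ε x + (p,q)`,
`ε = ±1`, `p q` integers. -/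
def IsP2 (γ : Pt → Pt) : Prop :=
  ∃ (ε : ℝ) (p q : ℤ), (ε = 1 ∨ ε = -1) ∧ γ = fun x => ε • x + ![(p:ℝ), (q:ℝ)]

/-- If `w` is expanded by `f`, the compact sets `X` and `Y` satisfy `f X ⊆ X + D` and
`Y + D ⊆ f Y`, and `Y` is nonempty, then `X ⊆ Y`. -/
lemma subset_of_expanding {E : Type*} [AddCommGroup E] [TopologicalSpace E]
    [IsTopologicalAddGroup E] (f : E →+ E) (D : Set E) (w : E → ℝ) (hw : Continuous w)
    (hw0 : ∀ z, w z ≤ 0 → z = 0) {c : ℝ} (hc : 1 < c) (hf : ∀ z, c * w z ≤ w (f z))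
    {X Y : Set E} (hXc : IsCompact X) (hYc : IsCompact Y) (hYne : Y.Nonempty)
    (hX : f '' X ⊆ X + D) (hY : Y + D ⊆ f '' Y) : X ⊆ Y := by
  have hc0 : 0 < c := by linarith
  obtain ⟨K, hK⟩ := ((hXc.prod hYc).image
    (f := fun p : E × E => w (p.1 - p.2)) (by fun_prop)).bddAbove
  have key : ∀ n : ℕ, ∀ x ∈ X, ∃ y ∈ Y, w (x - y) ≤ K * c⁻¹ ^ n := by
    intro n
    induction n with
    | zero =>
      intro x hx
      obtain ⟨y, hy⟩ := hYne
      exact ⟨y, hy, by simpa using hK (mem_image_of_mem _ (mk_mem_prod hx hy))⟩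
    | succ n ih =>
      intro x hx
      obtain ⟨x', hx', d, hd, hxd⟩ := hX (mem_image_of_mem f hx)
      obtain ⟨y', hy', hle⟩ := ih x' hx'
      obtain ⟨y, hy, hyd⟩ := hY (add_mem_add hy' hd)
      refine ⟨y, hy, ?_⟩
      have h := hf (x - y)
      rw [map_sub, ← hxd, hyd, add_sub_add_right_eq_sub] at h
      rw [pow_succ, ← mul_assoc, ← div_eq_mul_inv, le_div_iff₀ hc0]
      linarith
  intro x hx
  obtain ⟨y, hy, hmin⟩ := hYc.exists_isMinOn hYne
    (f := fun y => w (x - y)) (by fun_prop)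
  have hlim : Filter.Tendsto (fun n : ℕ => K * c⁻¹ ^ n) Filter.atTop (nhds (K * 0)) :=
    (tendsto_pow_atTop_nhds_zero_of_lt_one (by positivity) (inv_lt_one_of_one_lt₀ hc)).const_mul K
  have hle : w (x - y) ≤ K * 0 := by
    refine ge_of_tendsto' hlim fun n => ?_
    obtain ⟨y', hy', h⟩ := key n x hx
    exact (hmin hy').trans h
  have hxy : x = y := sub_eq_zero.1 (hw0 _ (by simpa using hle))
  rwa [hxy]

/-- A positive definite quadratic form that the matrix `!![0, -b; 1, -a]` does not decrease. -/
def lyapunovForm (a b u v : ℝ) : ℝ := (b + 1) * (u ^ 2 + v ^ 2) - 2 * a * u * v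

lemma lyapunovForm_step (a b u v : ℝ) :
    lyapunovForm a b (-b * v) (u - a * v)
      = lyapunovForm a b u v + (b - 1) * ((b + 1) ^ 2 - a ^ 2) * v ^ 2 := by
  unfold lyapunovForm
  ring

lemma le_lyapunovForm {a b : ℝ} (hab : |a| ≤ b) (u v : ℝ) :
    u ^ 2 + v ^ 2 ≤ lyapunovForm a b u v := by
  obtain ⟨h1, h2⟩ := abs_le.1 hab
  unfold lyapunovForm
  nlinarith [mul_nonneg (by linarith : 0 ≤ b - a) (sq_nonneg (u + v)),
    mul_nonneg (by linarith : 0 ≤ b + a) (sq_nonneg (u - v))]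

lemma lyapunovForm_le {a b : ℝ} (hab : |a| ≤ b) (u v : ℝ) :
    lyapunovForm a b u v ≤ (2 * b + 1) * (u ^ 2 + v ^ 2) := by
  obtain ⟨h1, h2⟩ := abs_le.1 hab
  unfold lyapunovForm
  nlinarith [mul_nonneg (by linarith : 0 ≤ b - a) (sq_nonneg (u - v)),
    mul_nonneg (by linarith : 0 ≤ b + a) (sq_nonneg (u + v))]

/-- The sum of `lyapunovForm` over two consecutive points of an orbit is strictly expanded. -/
lemma exists_expansion {a b : ℝ} (hab : |a| ≤ b) (hb : 2 ≤ b) :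
    ∃ c : ℝ, 1 < c ∧ ∀ u v : ℝ,
      c * (lyapunovForm a b u v + lyapunovForm a b (-b * v) (u - a * v))
        ≤ lyapunovForm a b (-b * v) (u - a * v)
          + lyapunovForm a b (-b * (u - a * v)) (-b * v - a * (u - a * v)) := by
  obtain ⟨h1, h2⟩ := abs_le.1 hab
  obtain ⟨d, hd⟩ : ∃ d, d = (b - 1) * ((b + 1) ^ 2 - a ^ 2) := ⟨_, rfl⟩
  have hd0 : 0 < d := by
    rw [hd]
    exact mul_pos (by linarith) (by nlinarith)
  have hC : 0 < 4 * b + 2 + d := by linarith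
  refine ⟨1 + d / ((2 * a ^ 2 + 3) * (4 * b + 2 + d)), ?_, fun u v => ?_⟩
  · have : 0 < d / ((2 * a ^ 2 + 3) * (4 * b + 2 + d)) := by positivity
    linarith
  rw [lyapunovForm_step a b (-b * v) (u - a * v), lyapunovForm_step a b u v, ← hd]
  have hQ := lyapunovForm_le hab u v
  have hW : 2 * lyapunovForm a b u v + d * v ^ 2 ≤ (4 * b + 2 + d) * (u ^ 2 + v ^ 2) := by
    nlinarith [mul_nonneg hd0.le (sq_nonneg u)]
  have hS : u ^ 2 + v ^ 2 ≤ (2 * a ^ 2 + 3) * (v ^ 2 + (u - a * v) ^ 2) := by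
    nlinarith [sq_nonneg (u - 2 * a * v), sq_nonneg (a * (u - a * v)), sq_nonneg v,
      sq_nonneg (u - a * v)]
  have hmain : d / ((2 * a ^ 2 + 3) * (4 * b + 2 + d)) * (2 * lyapunovForm a b u v + d * v ^ 2)
      ≤ d * (v ^ 2 + (u - a * v) ^ 2) := by
    rw [div_mul_eq_mul_div, div_le_iff₀ (by positivity), mul_assoc]
    refine mul_le_mul_of_nonneg_left ?_ hd0.le
    nlinarith [mul_le_mul_of_nonneg_left hS hC.le]
  linarith

lemma LatEq.image_eq_add {A B : ℤ} {L : Set Pt} (hL : LatEq A B L) :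
    (Matrix.mulVecLin !![0, -(B:ℝ); 1, -(A:ℝ)]).toAddMonoidHom '' L
      = L + (fun i : ℤ => (![(i:ℝ), 0] : Pt)) '' Icc 0 (B - 1) := by
  refine Eq.trans hL ?_
  ext x
  simp only [mem_iUnion, Finset.mem_Icc, mem_image, mem_add, mem_Icc]
  constructor
  · rintro ⟨i, hi, y, hy, rfl⟩
    exact ⟨y, hy, _, ⟨i, hi, rfl⟩, rfl⟩
  · rintro ⟨y, hy, _, ⟨i, hi, rfl⟩, rfl⟩
    exact ⟨i, hi, y, hy, rfl⟩

lemma LatEq.subset {A B : ℤ} (hAB : |A| ≤ B) (hB : 2 ≤ B) {X Y : Set Pt}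
    (hXc : IsCompact X) (hYc : IsCompact Y) (hYne : Y.Nonempty)
    (hX : LatEq A B X) (hY : LatEq A B Y) : X ⊆ Y := by
  have hab : |(A:ℝ)| ≤ B := by exact_mod_cast hAB
  obtain ⟨c, hc, hexp⟩ := exists_expansion hab (by exact_mod_cast hB)
  refine subset_of_expanding (Matrix.mulVecLin !![0, -(B:ℝ); 1, -(A:ℝ)]).toAddMonoidHom _
    (fun z => lyapunovForm A B (z 0) (z 1)
      + lyapunovForm A B (-(B:ℝ) * z 1) (z 0 - A * z 1)) ?_ ?_ hc ?_ hXc hYc hYne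
    hX.image_eq_add.subset hY.image_eq_add.superset
  · unfold lyapunovForm
    fun_prop
  · intro z hz
    have h1 := le_lyapunovForm hab (z 0) (z 1)
    have h2 := le_lyapunovForm hab (-(B:ℝ) * z 1) (z 0 - A * z 1)
    ext i
    fin_cases i <;> simp only [Fin.zero_eta, Fin.mk_one, Pi.zero_apply] <;> nlinarith
  · intro z
    have h := hexp (z 0) (z 1)
    have h0 : (!![0, -(B:ℝ); 1, -(A:ℝ)]).mulVec z 0 = -(B:ℝ) * z 1 := by
      simp [Matrix.mulVec, dotProduct, Fin.sum_univ_two]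
    have h1 : (!![0, -(B:ℝ); 1, -(A:ℝ)]).mulVec z 1 = z 0 - A * z 1 := by
      simp [Matrix.mulVec, dotProduct, Fin.sum_univ_two, sub_eq_add_neg]
    simpa only [LinearMap.toAddMonoidHom_coe, Matrix.mulVecLin_apply, h0, h1] using h

lemma CrysEq.latEq {A B : ℤ} (hB : 2 ≤ B) {T : Set Pt} (hT : CrysEq A B T) {v : Pt}
    (hv : (!![0, -(B:ℝ); 1, -(A:ℝ)]).mulVec v = v + ![((B:ℝ)-1)/2, 0]) :
    LatEq A B ((fun x => x + v) '' (T ∪ -T)) := by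
  unfold CrysEq at hT
  unfold LatEq
  generalize !![0, -(B:ℝ); 1, -(A:ℝ)] = M at *
  obtain ⟨p, hp⟩ : ∃ p : Pt, p = ![((B:ℝ)-1)/2, 0] := ⟨_, rfl⟩
  obtain ⟨e, he⟩ : ∃ e : ℤ → Pt, e = fun i : ℤ => (![(i:ℝ), 0] : Pt) := ⟨_, rfl⟩
  have e0 : e 0 = 0 := by ext j; fin_cases j <;> simp [he]
  have erefl : ∀ i, e (B - 1 - i) = p + p - e i := by
    intro i
    ext j
    fin_cases j <;> simp [he, hp]
  have elast : e (B - 1) = p + p := by simpa [e0] using erefl 0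
  simp only [← hp, show ∀ i : ℤ, (![(i:ℝ), 0] : Pt) = e i from fun i => by rw [he]] at hT hv ⊢
  have split : ∀ x ∈ T, (∃ i ∈ Finset.Icc 0 (B - 2), ∃ t ∈ T, t + e i = M.mulVec x + p)
      ∨ -(M.mulVec x + p) ∈ T := by
    intro x hx
    simpa only [mem_union, mem_iUnion, mem_image, exists_prop, Set.mem_neg] using
      hT.subset (mem_image_of_mem _ hx)
  have lift_add : ∀ t ∈ T, ∀ i, 0 ≤ i → i ≤ B - 2 → ∃ x ∈ T, M.mulVec x + p = t + e i := by
    intro t ht i h0 h1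
    exact hT.superset (Or.inl (mem_biUnion (Finset.mem_Icc.2 ⟨h0, h1⟩) (mem_image_of_mem _ ht)))
  have lift_neg : ∀ t ∈ T, ∃ x ∈ T, M.mulVec x + p = -t := by
    intro t ht
    exact hT.superset (Or.inr (by simpa using ht))
  apply Subset.antisymm
  · rintro _ ⟨_, ⟨x, hx, rfl⟩, rfl⟩
    suffices h : ∃ i ∈ Finset.Icc 0 (B - 1), ∃ u ∈ T ∪ -T, M.mulVec x + p = u + e i by
      obtain ⟨i, hi, u, hu, h⟩ := h
      refine mem_biUnion hi ⟨u + v, ⟨u, hu, rfl⟩, ?_⟩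
      simp only [Matrix.mulVec_add, hv]
      linear_combination -h
    rcases hx with hx | hx
    · rcases split x hx with ⟨i, hi, t, ht, h⟩ | h
      · rw [Finset.mem_Icc] at hi
        exact ⟨i, Finset.mem_Icc.2 ⟨hi.1, by lia⟩, t, Or.inl ht, h.symm⟩
      · exact ⟨0, Finset.mem_Icc.2 ⟨le_rfl, by lia⟩, _, Or.inr h, by rw [e0, add_zero]⟩
    · rcases split (-x) hx with ⟨i, hi, t, ht, h⟩ | h
      · rw [Finset.mem_Icc] at hi
        refine ⟨B - 1 - i, Finset.mem_Icc.2 ⟨by lia, by lia⟩, -t, Or.inr (by simpa using ht), ?_⟩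
        rw [Matrix.mulVec_neg] at h
        rw [erefl]
        linear_combination h
      · refine ⟨B - 1, Finset.mem_Icc.2 ⟨by lia, le_rfl⟩, _, Or.inl h, ?_⟩
        rw [elast, Matrix.mulVec_neg]
        abel
  · intro y hy
    simp only [mem_iUnion, mem_image, exists_prop, Finset.mem_Icc] at hy
    obtain ⟨i, ⟨hi0, hi1⟩, _, ⟨u, hu, rfl⟩, rfl⟩ := hy
    suffices h : ∃ x ∈ T ∪ -T, M.mulVec x + p = u + e i by
      obtain ⟨x, hx, h⟩ := h
      refine ⟨x + v, ⟨x, hx, rfl⟩, ?_⟩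
      simp only [Matrix.mulVec_add, hv]
      linear_combination h
    rcases hu with hu | hu
    · rcases hi1.lt_or_eq with hi | rfl
      · obtain ⟨x, hx, h⟩ := lift_add u hu i hi0 (by lia)
        exact ⟨x, Or.inl hx, h⟩
      · obtain ⟨x, hx, h⟩ := lift_neg u hu
        refine ⟨-x, Or.inr (by simpa using hx), ?_⟩
        rw [elast, Matrix.mulVec_neg]
        linear_combination -h
    · rcases hi0.lt_or_eq with hi | rfl
      · obtain ⟨x, hx, h⟩ := lift_add (-u) hu (B - 1 - i) (by lia) (by lia)
        refine ⟨-x, Or.inr (by simpa using hx), ?_⟩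
        rw [erefl] at h
        rw [Matrix.mulVec_neg]
        linear_combination -h
      · obtain ⟨x, hx, h⟩ := lift_neg (-u) hu
        exact ⟨x, Or.inl hx, by rw [h, e0, neg_neg, add_zero]⟩

theorem stmt_2 (A B : ℤ) (hAB : |A| ≤ B) (hB : 2 ≤ B)
    (T : Set Pt) (hTne : T.Nonempty) (hTc : IsCompact T) (hT : CrysEq A B T)
    (L : Set Pt) (hLne : L.Nonempty) (hLc : IsCompact L) (hL : LatEq A B L) :
    IsUnit (!![0, -(B:ℝ); 1, -(A:ℝ)] - 1) ∧
    L = (fun x => x + (!![0, -(B:ℝ); 1, -(A:ℝ)] - 1)⁻¹.mulVec ![((B:ℝ)-1)/2, 0]) '' (T ∪ -T) := by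
  have hdet : IsUnit (!![0, -(B:ℝ); 1, -(A:ℝ)] - 1).det := by
    have h : (0:ℝ) < A + 1 + B := by
      have := (abs_le.1 hAB).1
      exact_mod_cast (by lia : 0 < A + 1 + B)
    rw [isUnit_iff_ne_zero, Matrix.det_fin_two]
    simp
    linarith
  refine ⟨(Matrix.isUnit_iff_isUnit_det _).2 hdet, ?_⟩
  have hv : (!![0, -(B:ℝ); 1, -(A:ℝ)]).mulVec
      ((!![0, -(B:ℝ); 1, -(A:ℝ)] - 1)⁻¹.mulVec ![((B:ℝ)-1)/2, 0])
      = (!![0, -(B:ℝ); 1, -(A:ℝ)] - 1)⁻¹.mulVec ![((B:ℝ)-1)/2, 0] + ![((B:ℝ)-1)/2, 0] := by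
    rw [← sub_eq_iff_eq_add']
    have h := Matrix.mulVec_mulVec ![((B:ℝ)-1)/2, 0] (!![0, -(B:ℝ); 1, -(A:ℝ)] - 1)
      (!![0, -(B:ℝ); 1, -(A:ℝ)] - 1)⁻¹
    rwa [Matrix.mul_nonsing_inv _ hdet, Matrix.one_mulVec, Matrix.sub_mulVec,
      Matrix.one_mulVec] at h
  have hL' := hT.latEq hB hv
  have hc := (hTc.union hTc.neg).image
    (f := fun x => x + (!![0, -(B:ℝ); 1, -(A:ℝ)] - 1)⁻¹.mulVec ![((B:ℝ)-1)/2, 0]) (by fun_prop)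
  exact (hL.subset hAB hB hLc hc (hTne.inl.image _) hL').antisymm
    (hL'.subset hAB hB hc hLc hLne hL)
end
end

section
/- Let A, B be integers with |A| ≤ B and B ≥ 2, let M be the 2×2 real matrix with rows (0, −B) and (1, −A), and let T be the unique nonempty compact subset of ℝ² satisfying M·T + ((B−1)/2, 0) = (⋃_{i=0}^{B−2} (T + (i,0))) ∪ (−T). Then the family {γ(T) : γ ∈ Γ} is a tiling of the plane: ⋃_{γ ∈ Γ} γ(T) = ℝ², and for any two distinct γ, γ′ ∈ Γ the interiors of γ(T) and γ′(T) are disjoint. -/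
open Set Pointwise

noncomputable section

/-- A termination measure for the shift radix recursion `(a, b) ↦ (t, a)`. -/
def srsRank (a b : ℤ) : ℤ :=
  3 * max (max |a| |b|) |a + b| + if b = 0 then 2 else if |b| ≤ |a| then 1 else 0

theorem srsRank_nonneg (a b : ℤ) : 0 ≤ srsRank a b := by
  have := abs_nonneg (a + b)
  unfold srsRank
  split_ifs <;> omega

theorem srsRank_neg (a b : ℤ) : srsRank (-a) (-b) = srsRank a b := by
  unfold srsRank
  rw [← neg_add, abs_neg, abs_neg, abs_neg]
  simp

theorem exists_trunc {B : ℤ} (hB : 2 ≤ B) (c : ℤ) :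
    ∃ t : ℤ, |B * t + c| ≤ B - 1 ∧
      ((0 ≤ c ∧ t ≤ 0 ∧ B * (-t) ≤ c) ∨ (c < 0 ∧ 0 ≤ t ∧ B * t ≤ -c)) := by
  rcases le_or_gt 0 c with hc | hc
  · refine ⟨-(c / B), ?_, Or.inl ⟨hc, ?_, ?_⟩⟩
    · have h1 := Int.mul_ediv_add_emod c B
      have h2 := Int.emod_nonneg c (by omega : B ≠ 0)
      have h3 := Int.emod_lt_of_pos c (by omega : 0 < B)
      rw [abs_le]
      constructor <;> nlinarith
    · have := Int.ediv_nonneg hc (by omega : 0 ≤ B)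
      omega
    · have h1 := Int.mul_ediv_add_emod c B
      have h2 := Int.emod_nonneg c (by omega : B ≠ 0)
      nlinarith
  · refine ⟨(-c) / B, ?_, Or.inr ⟨hc, ?_, ?_⟩⟩
    · have h1 := Int.mul_ediv_add_emod (-c) B
      have h2 := Int.emod_nonneg (-c) (by omega : B ≠ 0)
      have h3 := Int.emod_lt_of_pos (-c) (by omega : 0 < B)
      rw [abs_le]
      constructor <;> nlinarith
    · exact Int.ediv_nonneg (by omega) (by omega : 0 ≤ B)
    · have h1 := Int.mul_ediv_add_emod (-c) B
      have h2 := Int.emod_nonneg (-c) (by omega : B ≠ 0)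
      nlinarith

theorem exists_srsRank_lt_of_nonneg {A B : ℤ} (hA : 1 ≤ A) (hAB : A ≤ B) (hB : 2 ≤ B)
    {a b : ℤ} (ha : 0 ≤ a) (hab : a ≠ 0 ∨ b ≠ 0) :
    ∃ t : ℤ, |B * t + A * a + b| ≤ B - 1 ∧ srsRank t a < srsRank a b := by
  obtain ⟨t, ht, h⟩ := exists_trunc hB (A * a + b)
  refine ⟨t, by rwa [add_assoc], ?_⟩
  clear ht
  have hAa : a ≤ A * a := by nlinarith
  have hBa : A * a ≤ B * a := by nlinarith
  rcases h with ⟨hc, ht0, hle⟩ | ⟨hc, ht0, hle⟩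
  · have h2 : 2 * (-t) ≤ B * (-t) := by nlinarith
    rcases lt_trichotomy b 0 with hb | hb | hb
    · have : -t < a := by nlinarith
      simp only [srsRank, abs_eq_max_neg]
      split_ifs <;> omega
    · have : -t ≤ a := by nlinarith
      simp only [srsRank, abs_eq_max_neg]
      split_ifs <;> omega
    · have : -t < a + b := by
        by_contra! hcon
        nlinarith
      simp only [srsRank, abs_eq_max_neg]
      split_ifs <;> omega
  · have h2 : 2 * t ≤ B * t := by nlinarith
    simp only [srsRank, abs_eq_max_neg]
    split_ifs <;> omega

theorem exists_srsRank_lt {A B : ℤ} (hA : 1 ≤ A) (hAB : A ≤ B) (hB : 2 ≤ B)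
    {a b : ℤ} (hab : a ≠ 0 ∨ b ≠ 0) :
    ∃ t : ℤ, |B * t + A * a + b| ≤ B - 1 ∧ srsRank t a < srsRank a b := by
  rcases le_total 0 a with ha | ha
  · exact exists_srsRank_lt_of_nonneg hA hAB hB ha hab
  · obtain ⟨t, h1, h2⟩ := exists_srsRank_lt_of_nonneg (a := -a) (b := -b) hA hAB hB
      (by omega) (by omega)
    refine ⟨-t, ?_, ?_⟩
    · rw [← abs_neg]
      convert h1 using 2
      ring
    · rw [srsRank_neg] at h2
      rwa [← srsRank_neg, neg_neg]

theorem srs_induction_of_nonneg {A B : ℤ} (hA : 0 ≤ A) (hAB : A ≤ B) (hB : 2 ≤ B)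
    {P : ℤ → ℤ → Prop} (h0 : P 0 0)
    (h : ∀ a b t, |B * t + A * a + b| ≤ B - 1 → P t a → P a b) (a b : ℤ) : P a b := by
  obtain ⟨m, hm0, hm⟩ : ∃ m : ℤ → ℤ → ℤ, (∀ a b, 0 ≤ m a b) ∧ ∀ a b, a ≠ 0 ∨ b ≠ 0 →
      ∃ t : ℤ, |B * t + A * a + b| ≤ B - 1 ∧ m t a < m a b := by
    rcases hA.eq_or_lt with rfl | hA
    · refine ⟨fun a b => 3 * |a| + 2 * |b|, fun a b => by positivity, fun a b hab => ?_⟩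
      obtain ⟨t, ht, h⟩ := exists_trunc hB b
      refine ⟨t, by simpa using ht, ?_⟩
      have h2 : 2 * |t| ≤ |b| := by
        rcases h with ⟨hc, ht0, hle⟩ | ⟨hc, ht0, hle⟩
        · have : 2 * (-t) ≤ B * (-t) := by nlinarith
          rw [abs_of_nonpos ht0, abs_of_nonneg hc]
          linarith
        · have : 2 * t ≤ B * t := by nlinarith
          rw [abs_of_nonneg ht0, abs_of_neg hc]
          linarith
      have ha := abs_nonneg a
      have hb := abs_nonneg b
      simp only [← abs_pos] at hab
      simp only
      omega
    · exact ⟨srsRank, srsRank_nonneg, fun a b hab => exists_srsRank_lt hA hAB hB hab⟩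
  induction hn : (m a b).toNat using Nat.strong_induction_on generalizing a b with
  | _ n ih =>
    by_cases hab : a ≠ 0 ∨ b ≠ 0
    · obtain ⟨t, h1, h2⟩ := hm a b hab
      have := hm0 t a
      exact h a b t h1 (ih _ (by omega) t a rfl)
    · push Not at hab
      rw [hab.1, hab.2]
      exact h0

/-- Every state of the recursion `|B t + A a + b| ≤ B - 1` can be driven to zero. -/
theorem srs_induction {A B : ℤ} (hAB : |A| ≤ B) (hB : 2 ≤ B)
    {P : ℤ → ℤ → Prop} (h0 : P 0 0)
    (h : ∀ a b t, |B * t + A * a + b| ≤ B - 1 → P t a → P a b) (a b : ℤ) : P a b := by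
  rcases le_total 0 A with hA | hA
  · exact srs_induction_of_nonneg hA (le_of_abs_le hAB) hB h0 h a b
  · have key := srs_induction_of_nonneg (A := -A) (B := B) (by omega)
      (by rw [abs_of_nonpos hA] at hAB; exact hAB) hB
      (P := fun a b => P a (-b) ∧ P (-a) b) (by simpa using h0) ?_
    · simpa using (key a (-b)).1
    · rintro a b t ht ⟨h1, h2⟩
      refine ⟨h a (-b) (-t) ?_ h2, h (-a) b t ?_ h1⟩
      · rw [← abs_neg]
        convert ht using 2
        ring
      · convert ht using 2
        ring

theorem measure_inter_eq_zero_of_sum_le {α ι : Type*} [MeasurableSpace α]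
    {μ : MeasureTheory.Measure α} [DecidableEq ι] (s : Finset ι) (f : ι → Set α)
    (hf : ∀ i, MeasurableSet (f i)) (hfin : ∀ i, μ (f i) ≠ ⊤)
    (h : ∑ i ∈ s, μ (f i) ≤ μ (⋃ i ∈ s, f i)) {i j : ι} (hi : i ∈ s) (hj : j ∈ s)
    (hij : i ≠ j) : μ (f i ∩ f j) = 0 := by
  have hj' : j ∈ s.erase i := Finset.mem_erase.2 ⟨hij.symm, hj⟩
  have hsum : ∑ k ∈ s, μ (f k)
      = (μ (f i) + μ (f j)) + ∑ k ∈ (s.erase i).erase j, μ (f k) := by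
    rw [← Finset.add_sum_erase s _ hi, ← Finset.add_sum_erase _ _ hj', add_assoc]
  have hsub : (⋃ k ∈ s, f k) ⊆ (f i ∪ f j) ∪ ⋃ k ∈ (s.erase i).erase j, f k := by
    intro x hx
    simp only [mem_iUnion, exists_prop, mem_union, Finset.mem_erase] at hx ⊢
    obtain ⟨k, hk, hxk⟩ := hx
    by_cases h1 : k = i
    · subst h1; exact Or.inl (Or.inl hxk)
    by_cases h2 : k = j
    · subst h2; exact Or.inl (Or.inr hxk)
    exact Or.inr ⟨k, ⟨h2, h1, hk⟩, hxk⟩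
  have hle : μ (⋃ k ∈ s, f k) ≤ μ (f i ∪ f j) + ∑ k ∈ (s.erase i).erase j, μ (f k) :=
    (MeasureTheory.measure_mono hsub).trans <| (MeasureTheory.measure_union_le _ _).trans <|
      add_le_add le_rfl (MeasureTheory.measure_biUnion_finset_le _ _)
  have hunion := MeasureTheory.measure_union_add_inter (μ := μ) (f i) (hf j)
  have hS : ∑ k ∈ s, μ (f k) ≠ ⊤ := ENNReal.sum_ne_top.2 fun k _ => hfin k
  have : ∑ k ∈ s, μ (f k) + μ (f i ∩ f j) ≤ ∑ k ∈ s, μ (f k) + 0 := by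
    calc ∑ k ∈ s, μ (f k) + μ (f i ∩ f j)
        ≤ (μ (f i ∪ f j) + ∑ k ∈ (s.erase i).erase j, μ (f k)) + μ (f i ∩ f j) :=
          add_le_add (h.trans hle) le_rfl
      _ = (μ (f i ∪ f j) + μ (f i ∩ f j)) + ∑ k ∈ (s.erase i).erase j, μ (f k) := by ring
      _ = ∑ k ∈ s, μ (f k) + 0 := by rw [hunion, hsum, add_zero]
  exact le_antisymm ((ENNReal.add_le_add_iff_left hS).1 this) zero_le

/-- The affine expansion appearing in `CrysEq`. -/
def expand (A B : ℤ) (x : Pt) : Pt :=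
  (!![0, -(B:ℝ); 1, -(A:ℝ)]).mulVec x + ![((B:ℝ)-1)/2, 0]

theorem expand_zero (A B : ℤ) (x : Pt) : expand A B x 0 = -B * x 1 + ((B:ℝ)-1)/2 := by
  simp [expand, dotProduct, Fin.sum_univ_two]

theorem expand_one (A B : ℤ) (x : Pt) : expand A B x 1 = x 0 - A * x 1 := by
  simp [expand, dotProduct, Fin.sum_univ_two]
  ring

theorem volume_image_add_right (s : Set Pt) (v : Pt) :
    MeasureTheory.volume ((fun x => x + v) '' s) = MeasureTheory.volume s := by
  rw [image_add_right, MeasureTheory.measure_preimage_add_right]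

theorem volume_expand_image {A B : ℤ} (hB : 0 ≤ B) (s : Set Pt) :
    MeasureTheory.volume (expand A B '' s) = ENNReal.ofReal B * MeasureTheory.volume s := by
  have h : expand A B '' s = (fun x => x + ![((B:ℝ)-1)/2, 0]) ''
      ((Matrix.toLin' !![0, -(B:ℝ); 1, -(A:ℝ)]) '' s) := by
    rw [image_image]
    rfl
  rw [h, volume_image_add_right, MeasureTheory.Measure.addHaar_image_linearMap]
  have : (0:ℝ) ≤ B := by exact_mod_cast hB
  simp [LinearMap.det_toLin', Matrix.det_fin_two, abs_of_nonneg this]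

theorem expand_injective {A B : ℤ} (hB : B ≠ 0) : Function.Injective (expand A B) := by
  intro x y h
  have h0 := congrFun h 0
  have h1 := congrFun h 1
  rw [expand_zero, expand_zero] at h0
  rw [expand_one, expand_one] at h1
  have hB' : (B:ℝ) ≠ 0 := by exact_mod_cast hB
  have hy : x 1 = y 1 := by
    apply mul_left_cancel₀ hB'
    linarith
  have hx : x 0 = y 0 := by
    rw [hy] at h1
    linarith
  ext i
  fin_cases i
  · exact hx
  · exact hy

/-- A set `U` with `M U + ((B-1)/2, 0) = U + {0, …, B-1}`. -/
def CentredEq (A B : ℤ) (U : Set Pt) : Prop :=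
  expand A B '' U = ⋃ i ∈ Finset.Icc (0:ℤ) (B-1), (fun x => x + ![(i:ℝ), 0]) '' U

theorem CrysEq.centredEq {A B : ℤ} {T : Set Pt} (hT : CrysEq A B T) (hB : 2 ≤ B) :
    CentredEq A B (T ∪ -T) := by
  have hneg : ∀ x, expand A B (-x) = -expand A B x + ![((B - 1 : ℤ):ℝ), 0] := by
    intro x
    ext i
    fin_cases i
    · simp [expand_zero]; ring
    · simp [expand_one]; ring
  have hT' : expand A B '' T
    = (⋃ i ∈ Finset.Icc (0:ℤ) (B-2), (fun x => x + ![(i:ℝ), 0]) '' T) ∪ (-T) := hT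
  have hsub : ∀ i j : ℤ, ∀ y : Pt,
      -(y + ![(i:ℝ), 0]) + ![(j:ℝ), 0] = -y + ![((j - i : ℤ):ℝ), 0] := by
    intro i j y
    ext k
    fin_cases k
    · simp [Matrix.vecHead]; ring
    · simp [Matrix.vecHead, Matrix.vecTail]
  have hmem : ∀ p, p ∈ expand A B '' T ↔
      (∃ i : ℤ, (0 ≤ i ∧ i ≤ B - 2) ∧ ∃ y ∈ T, y + ![(i:ℝ), 0] = p) ∨ -p ∈ T := by
    intro p
    rw [hT']
    simp only [mem_union, mem_iUnion, Finset.mem_Icc, mem_image, exists_prop, mem_neg]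
  unfold CentredEq
  ext p
  simp only [mem_iUnion, Finset.mem_Icc, exists_prop]
  constructor
  · rintro ⟨u, hu | hu, rfl⟩
    · rcases (hmem _).1 (mem_image_of_mem _ hu) with ⟨i, hi, y, hy, h⟩ | h
      · exact ⟨i, by omega, y, Or.inl hy, h⟩
      · refine ⟨0, by omega, expand A B u, Or.inr h, ?_⟩
        ext k
        fin_cases k <;> simp
    · have hu' : expand A B u = -expand A B (-u) + ![((B - 1 : ℤ):ℝ), 0] := by
        rw [← hneg, neg_neg]
      rcases (hmem _).1 (mem_image_of_mem _ hu) with ⟨i, hi, y, hy, h⟩ | h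
      · refine ⟨B - 1 - i, by omega, -y, Or.inr (by simpa using hy), ?_⟩
        rw [hu', ← h, hsub]
      · exact ⟨B - 1, by omega, -expand A B (-u), Or.inl h, hu'.symm⟩
  · rintro ⟨i, hi, w, hw | hw, rfl⟩
    · by_cases hi' : i ≤ B - 2
      · obtain ⟨x, hx, h⟩ := (hmem (w + ![(i:ℝ), 0])).2 (Or.inl ⟨i, by omega, w, hw, rfl⟩)
        exact ⟨x, Or.inl hx, h⟩
      · obtain ⟨x, hx, h⟩ := (hmem (-w)).2 (Or.inr (by simpa using hw))
        refine ⟨-x, Or.inr (by simpa using hx), ?_⟩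
        rw [hneg, h, neg_neg]
        obtain rfl : i = B - 1 := by omega
        rfl
    · by_cases hi' : i = 0
      · subst hi'
        obtain ⟨x, hx, h⟩ := (hmem w).2 (Or.inr hw)
        refine ⟨x, Or.inl hx, ?_⟩
        rw [h]
        ext k
        fin_cases k <;> simp
      · obtain ⟨x, hx, h⟩ := (hmem (-w + ![((B - 1 - i : ℤ):ℝ), 0])).2
          (Or.inl ⟨B - 1 - i, by omega, -w, hw, rfl⟩)
        refine ⟨-x, Or.inr (by simpa using hx), ?_⟩
        rw [hneg, h, hsub, neg_neg]
        simp

theorem CrysEq.volume_inter_neg {A B : ℤ} {T : Set Pt} (hT : CrysEq A B T) (hB : 2 ≤ B)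
    (hTc : IsCompact T) : MeasureTheory.volume (T ∩ -T) = 0 := by
  have hT' : expand A B '' T
    = (⋃ i ∈ Finset.Icc (0:ℤ) (B-2), (fun x => x + ![(i:ℝ), 0]) '' T) ∪ (-T) := hT
  let f : ℤ → Set Pt := fun i => if i = B - 1 then -T else (fun x => x + ![(i:ℝ), 0]) '' T
  have hf : ∀ i, IsCompact (f i) := by
    intro i
    simp only [f]
    split_ifs
    · exact hTc.neg
    · exact hTc.image (by fun_prop)
  have hvol : ∀ i, MeasureTheory.volume (f i) = MeasureTheory.volume T := by
    intro i
    simp only [f]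
    split_ifs
    · exact MeasureTheory.Measure.measure_neg _ _
    · exact volume_image_add_right _ _
  have hU : expand A B '' T = ⋃ i ∈ Finset.Icc (0:ℤ) (B-1), f i := by
    rw [hT']
    ext p
    simp only [mem_union, mem_iUnion, Finset.mem_Icc, exists_prop, f]
    constructor
    · rintro (⟨i, hi, h⟩ | h)
      · exact ⟨i, by omega, by rwa [if_neg (by omega)]⟩
      · exact ⟨B - 1, by omega, by rwa [if_pos rfl]⟩
    · rintro ⟨i, hi, h⟩
      split_ifs at h with hi'
      · exact Or.inr h
      · exact Or.inl ⟨i, by omega, h⟩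
  have hsum : ∑ i ∈ Finset.Icc (0:ℤ) (B-1), MeasureTheory.volume (f i)
      ≤ MeasureTheory.volume (⋃ i ∈ Finset.Icc (0:ℤ) (B-1), f i) := by
    rw [← hU, volume_expand_image (by omega), Finset.sum_congr rfl fun i _ => hvol i,
      Finset.sum_const, Int.card_Icc, nsmul_eq_mul]
    obtain ⟨n, rfl⟩ := Int.eq_ofNat_of_zero_le (by omega : 0 ≤ B)
    simp
  have := measure_inter_eq_zero_of_sum_le _ f (fun i => (hf i).measurableSet)
    (fun i => (hf i).measure_lt_top.ne) hsum (i := 0) (j := B - 1)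
    (by simp; omega) (by simp; omega) (by omega)
  have h0 : f 0 = T := by
    have : (![0, 0] : Pt) = 0 := by ext k; fin_cases k <;> rfl
    simp only [f]
    rw [if_neg (by omega)]
    simp [this]
  have h1 : f (B - 1) = -T := by simp [f]
  rwa [h0, h1] at this

theorem CentredEq.exists_expand_eq {A B : ℤ} {U : Set Pt} (hU : CentredEq A B U) {p : Pt}
    (hp : p ∈ U) {i : ℤ} (hi : 0 ≤ i) (hi' : i ≤ B - 1) :
    ∃ u ∈ U, expand A B u = p + ![(i:ℝ), 0] := by
  have : p + ![(i:ℝ), 0] ∈ expand A B '' U := by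
    rw [hU]
    simp only [mem_iUnion, Finset.mem_Icc, exists_prop]
    exact ⟨i, ⟨hi, hi'⟩, p, hp, rfl⟩
  exact this

theorem exists_digits_of_abs_le {B δ : ℤ} (hδ : |δ| ≤ B - 1) :
    ∃ i j : ℤ, (0 ≤ i ∧ i ≤ B - 1) ∧ (0 ≤ j ∧ j ≤ B - 1) ∧ j = i + δ := by
  rw [abs_le] at hδ
  rcases le_total 0 δ with h | h
  · exact ⟨0, δ, by omega, by omega, by omega⟩
  · exact ⟨-δ, 0, by omega, by omega, by omega⟩

theorem CentredEq.volume_inter_digit {A B : ℤ} {U : Set Pt} (hU : CentredEq A B U)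
    (hB : 2 ≤ B) (hUc : IsCompact U) {δ : ℤ} (hδ : |δ| ≤ B - 1) (hδ0 : δ ≠ 0) :
    MeasureTheory.volume {p : Pt | p ∈ U ∧ p - ![(δ:ℝ), 0] ∈ U} = 0 := by
  let f : ℤ → Set Pt := fun i => (fun x => x + ![(i:ℝ), 0]) '' U
  have hf : ∀ i, IsCompact (f i) := fun i => hUc.image (by fun_prop)
  have hsum : ∑ i ∈ Finset.Icc (0:ℤ) (B-1), MeasureTheory.volume (f i)
      ≤ MeasureTheory.volume (⋃ i ∈ Finset.Icc (0:ℤ) (B-1), f i) := by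
    have : expand A B '' U = ⋃ i ∈ Finset.Icc (0:ℤ) (B-1), f i := hU
    rw [← this, volume_expand_image (by omega),
      Finset.sum_congr rfl fun i _ => volume_image_add_right U _,
      Finset.sum_const, Int.card_Icc, nsmul_eq_mul]
    obtain ⟨n, rfl⟩ := Int.eq_ofNat_of_zero_le (by omega : 0 ≤ B)
    simp
  obtain ⟨i, j, hi, hj, hij⟩ := exists_digits_of_abs_le hδ
  have key := measure_inter_eq_zero_of_sum_le _ f (fun i => (hf i).measurableSet)
    (fun i => (hf i).measure_lt_top.ne) hsum (i := i) (j := j)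
    (by simpa using hi) (by simpa using hj) (by omega)
  rw [← volume_image_add_right _ ![(i:ℝ), 0]]
  refine MeasureTheory.measure_mono_null ?_ key
  rintro _ ⟨p, ⟨hp, hp'⟩, rfl⟩
  refine ⟨⟨p, hp, rfl⟩, ⟨_, hp', ?_⟩⟩
  subst hij
  ext k
  fin_cases k
  · simp [Matrix.vecHead]
  · simp [Matrix.vecHead, Matrix.vecTail]

theorem CentredEq.volume_inter_step {A B : ℤ} {U : Set Pt} (hU : CentredEq A B U)
    (hB : 2 ≤ B) {δ : ℤ} (hδ : |δ| ≤ B - 1) {x y : ℝ}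
    (h : MeasureTheory.volume {p : Pt | p ∈ U ∧ p - ![x, y] ∈ U} = 0) :
    MeasureTheory.volume {p : Pt | p ∈ U ∧ p - ![-B * y + δ, x - A * y] ∈ U} = 0 := by
  obtain ⟨i, j, hi, hj, hij⟩ := exists_digits_of_abs_le hδ
  have hF := volume_expand_image (A := A) (by omega : 0 ≤ B) {p : Pt | p ∈ U ∧ p - ![x, y] ∈ U}
  rw [h, mul_zero] at hF
  rw [← volume_image_add_right _ ![(i:ℝ), 0]]
  refine MeasureTheory.measure_mono_null ?_ hF
  rintro _ ⟨p, ⟨hp, hp'⟩, rfl⟩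
  obtain ⟨u, hu, hu'⟩ := hU.exists_expand_eq hp hi.1 hi.2
  obtain ⟨v, hv, hv'⟩ := hU.exists_expand_eq hp' hj.1 hj.2
  refine ⟨u, ⟨hu, ?_⟩, hu'⟩
  convert hv
  apply expand_injective (A := A) (B := B) (by omega)
  rw [hv']
  have h0 := congrFun hu' 0
  have h1 := congrFun hu' 1
  rw [expand_zero] at h0
  rw [expand_one] at h1
  simp at h0 h1
  subst hij
  ext k
  fin_cases k
  · simp [Matrix.vecHead, Matrix.vecTail, expand_zero]; linarith
  · simp [Matrix.vecHead, Matrix.vecTail, expand_one]; linarith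

theorem CentredEq.volume_inter_translate {A B : ℤ} {U : Set Pt} (hU : CentredEq A B U)
    (hAB : |A| ≤ B) (hB : 2 ≤ B) (hUc : IsCompact U) {p q : ℤ} (hpq : p ≠ 0 ∨ q ≠ 0) :
    MeasureTheory.volume {x : Pt | x ∈ U ∧ x - ![(p:ℝ), (q:ℝ)] ∈ U} = 0 := by
  have key := srs_induction hAB hB (P := fun a b => (a ≠ 0 ∨ b ≠ 0) →
    MeasureTheory.volume {x : Pt | x ∈ U ∧ x - ![((-b - A * a : ℤ):ℝ), ((-a : ℤ):ℝ)] ∈ U} = 0)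
    (by simp) ?_ (-q) (-p + A * q) ?_
  · convert key using 8
    · push_cast; ring_nf
    · push_cast; ring_nf
  · intro a b t ht ih hab
    by_cases h : t ≠ 0 ∨ a ≠ 0
    · have hδ : |-(B * t + A * a + b)| ≤ B - 1 := by rwa [abs_neg]
      convert hU.volume_inter_step hB hδ (ih h) using 8
      · push_cast; ring_nf
      · push_cast; ring_nf
    · push Not at h
      obtain ⟨rfl, rfl⟩ := h
      have hb : b ≠ 0 := by simpa using hab
      have := hU.volume_inter_digit hB hUc (δ := -b) (by simpa using ht) (by omega)
      simpa using this
  · by_contra! h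
    obtain ⟨h1, h2⟩ := h
    obtain rfl : q = 0 := by omega
    simp at h2
    omega

/-- A quadratic form that is strictly increased by the linear part of `expand`. -/
def lyapunov (A B x y : ℝ) : ℝ := (B + 1) * x ^ 2 - 2 * A * x * y + B * (B + 1) * y ^ 2

theorem lyapunov_cross {A B : ℝ} (hAB : |A| ≤ B) (x y : ℝ) :
    |2 * A * x * y| ≤ B * (x ^ 2 + y ^ 2) := by
  have h1 : |2 * A * x * y| = |A| * (2 * |x| * |y|) := by
    simp [abs_mul]; ring
  have h2 : 2 * |x| * |y| ≤ x ^ 2 + y ^ 2 := by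
    nlinarith [sq_nonneg (|x| - |y|), sq_abs x, sq_abs y]
  rw [h1]
  exact mul_le_mul hAB h2 (by positivity) ((abs_nonneg A).trans hAB)

theorem le_lyapunov {A B : ℝ} (hAB : |A| ≤ B) (hB : 2 ≤ B) (x y : ℝ) :
    x ^ 2 + y ^ 2 ≤ lyapunov A B x y := by
  have := (abs_le.1 (lyapunov_cross hAB x y)).2
  have hy : 0 ≤ (B ^ 2 - 1) * y ^ 2 := mul_nonneg (by nlinarith) (sq_nonneg y)
  unfold lyapunov
  linarith

theorem lyapunov_le {A B : ℝ} (hAB : |A| ≤ B) (hB : 2 ≤ B) (x y : ℝ) :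
    lyapunov A B x y ≤ 2 * B * (B + 1) * (x ^ 2 + y ^ 2) := by
  have := (abs_le.1 (lyapunov_cross hAB x y)).1
  have hx : 0 ≤ (2 * B ^ 2 - 1) * x ^ 2 := mul_nonneg (by nlinarith) (sq_nonneg x)
  have hy : 0 ≤ B ^ 2 * y ^ 2 := by positivity
  unfold lyapunov
  linarith

theorem lyapunov_contract {A B : ℝ} (hAB : |A| ≤ B) (hB : 2 ≤ B) (x y : ℝ) :
    lyapunov A B (y - A * x / B) (-x / B)
      ≤ (1 - 1 / (4 * B * (B + 1))) * lyapunov A B x y := by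
  have hB0 : 0 < B := by linarith
  have hdiff : lyapunov A B x y - lyapunov A B (y - A * x / B) (-x / B)
      = (B ^ 2 - 1) * y ^ 2 + (B - 1) * ((B + 1) / B - A ^ 2 / B ^ 2) * x ^ 2 := by
    unfold lyapunov
    field_simp
    ring
  have hA2 : A ^ 2 / B ^ 2 ≤ 1 := by
    rw [div_le_one (by positivity)]
    exact sq_le_sq' (by linarith [neg_abs_le A]) (by linarith [le_abs_self A])
  have h1 : 1 / B ≤ (B + 1) / B - A ^ 2 / B ^ 2 := by
    have : (B + 1) / B = 1 + 1 / B := by field_simp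
    linarith
  have h2 : 1 / 2 ≤ (B - 1) * (1 / B) := by
    rw [mul_one_div, div_le_div_iff₀ (by norm_num) hB0]
    linarith
  have h3 : 1 / 2 ≤ (B - 1) * ((B + 1) / B - A ^ 2 / B ^ 2) :=
    h2.trans (mul_le_mul_of_nonneg_left h1 (by linarith))
  have h4 : 1 / 2 * x ^ 2 ≤ (B - 1) * ((B + 1) / B - A ^ 2 / B ^ 2) * x ^ 2 :=
    mul_le_mul_of_nonneg_right h3 (sq_nonneg x)
  have h5 : 1 / 2 * y ^ 2 ≤ (B ^ 2 - 1) * y ^ 2 :=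
    mul_le_mul_of_nonneg_right (by nlinarith) (sq_nonneg y)
  have h6 : 1 / (4 * B * (B + 1)) * lyapunov A B x y ≤ 1 / 2 * (x ^ 2 + y ^ 2) := by
    calc 1 / (4 * B * (B + 1)) * lyapunov A B x y
        ≤ 1 / (4 * B * (B + 1)) * (2 * B * (B + 1) * (x ^ 2 + y ^ 2)) :=
          mul_le_mul_of_nonneg_left (lyapunov_le hAB hB x y) (by positivity)
      _ = 1 / 2 * (x ^ 2 + y ^ 2) := by field_simp; ring
  linarith

theorem isClosed_range_intLattice :
    IsClosed (range fun z : ℤ × ℤ => (![(z.1:ℝ), (z.2:ℝ)] : Pt)) := by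
  have h : (range fun z : ℤ × ℤ => (![(z.1:ℝ), (z.2:ℝ)] : Pt))
      = (fun v : Pt => v 0) ⁻¹' range ((↑) : ℤ → ℝ) ∩
        (fun v : Pt => v 1) ⁻¹' range ((↑) : ℤ → ℝ) := by
    ext v
    constructor
    · rintro ⟨z, rfl⟩
      exact ⟨⟨z.1, rfl⟩, ⟨z.2, rfl⟩⟩
    · rintro ⟨⟨p, hp⟩, ⟨q, hq⟩⟩
      refine ⟨(p, q), ?_⟩
      ext k
      fin_cases k
      · exact hp
      · exact hq
  rw [h]
  have hc := Int.isClosedEmbedding_coe_real.isClosed_range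
  exact (hc.preimage (continuous_apply 0)).inter (hc.preimage (continuous_apply 1))

theorem CentredEq.exists_add_eq {A B : ℤ} {U : Set Pt} (hU : CentredEq A B U)
    (hAB : |A| ≤ B) (hB : 2 ≤ B) (hUc : IsCompact U) (hUne : U.Nonempty) (y : Pt) :
    ∃ u ∈ U, ∃ p q : ℤ, u + ![(p:ℝ), (q:ℝ)] = y := by
  set Z : Set Pt := range fun z : ℤ × ℤ => (![(z.1:ℝ), (z.2:ℝ)] : Pt) with hZ
  have hcl : IsClosed (U + Z) := isClosed_range_intLattice.add_left_of_isCompact hUc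
  suffices hy : y ∈ U + Z by
    obtain ⟨u, hu, _, ⟨z, rfl⟩, h⟩ := hy
    exact ⟨u, hu, z.1, z.2, h⟩
  have hABr : |(A:ℝ)| ≤ B := by exact_mod_cast hAB
  have hBr : (2:ℝ) ≤ B := by exact_mod_cast hB
  have hB0 : (B:ℝ) ≠ 0 := by positivity
  set θ : ℝ := 1 - 1 / (4 * B * (B + 1)) with hθ
  have hθ1 : θ < 1 := by
    have : (0:ℝ) < 1 / (4 * B * (B + 1)) := by positivity
    linarith
  have hθ0 : 0 ≤ θ := by
    have : 1 / (4 * (B:ℝ) * (B + 1)) ≤ 1 := by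
      rw [div_le_one (by positivity)]
      nlinarith
    linarith
  set R : ℝ := 2 * B * (B + 1) * 2
  have happrox : ∀ n : ℕ, ∀ y : Pt, ∃ s ∈ U + Z,
      lyapunov A B (y 0 - s 0) (y 1 - s 1) ≤ θ ^ n * R := by
    intro n
    induction n with
    | zero =>
      intro y
      obtain ⟨u, hu⟩ := hUne
      refine ⟨u + ![((⌊y 0 - u 0⌋ : ℤ):ℝ), ((⌊y 1 - u 1⌋ : ℤ):ℝ)],
        add_mem_add hu ⟨(_, _), rfl⟩, ?_⟩
      refine (lyapunov_le hABr hBr _ _).trans ?_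
      rw [pow_zero, one_mul]
      refine mul_le_mul_of_nonneg_left ?_ (by positivity)
      have h1 := Int.floor_le (y 0 - u 0)
      have h2 := Int.lt_floor_add_one (y 0 - u 0)
      have h3 := Int.floor_le (y 1 - u 1)
      have h4 := Int.lt_floor_add_one (y 1 - u 1)
      simp only [Pi.add_apply, Matrix.cons_val_zero, Matrix.cons_val_one]
      nlinarith
    | succ n ih =>
      intro y
      obtain ⟨s, ⟨u, hu, _, ⟨⟨p, q⟩, rfl⟩, rfl⟩, hs⟩ := ih (expand A B y)
      have hdm := Int.mul_ediv_add_emod p B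
      obtain ⟨v, hv, hv'⟩ := hU.exists_expand_eq hu (i := p % B)
        (Int.emod_nonneg p (by omega)) (by have := Int.emod_lt_of_pos p (by omega : 0 < B); omega)
      have h0 := congrFun hv' 0
      have h1 := congrFun hv' 1
      rw [expand_zero] at h0
      rw [expand_one] at h1
      simp at h0 h1
      refine ⟨v + ![((q - A * (p / B) : ℤ):ℝ), ((-(p / B) : ℤ):ℝ)],
        add_mem_add hv ⟨(_, _), rfl⟩, ?_⟩
      have hdm' : (B:ℝ) * ((p / B : ℤ):ℝ) + ((p % B : ℤ):ℝ) = p := by exact_mod_cast hdm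
      have hc := lyapunov_contract hABr hBr
        (expand A B y 0 - (u + ![(p:ℝ), (q:ℝ)]) 0) (expand A B y 1 - (u + ![(p:ℝ), (q:ℝ)]) 1)
      have e1 : -(expand A B y 0 - (u + ![(p:ℝ), (q:ℝ)]) 0) / B
          = y 1 - (v + ![((q - A * (p / B) : ℤ):ℝ), ((-(p / B) : ℤ):ℝ)]) 1 := by
        rw [div_eq_iff hB0, expand_zero]
        simp
        linarith
      have e0 : (expand A B y 1 - (u + ![(p:ℝ), (q:ℝ)]) 1)
          - A * (expand A B y 0 - (u + ![(p:ℝ), (q:ℝ)]) 0) / B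
          = y 0 - (v + ![((q - A * (p / B) : ℤ):ℝ), ((-(p / B) : ℤ):ℝ)]) 0 := by
        rw [mul_div_assoc, ← neg_neg ((expand A B y 0 - (u + ![(p:ℝ), (q:ℝ)]) 0) / (B:ℝ)),
          ← neg_div, e1, expand_one]
        simp
        linarith
      rw [e0, e1] at hc
      calc _ ≤ _ := hc
        _ ≤ θ * (θ ^ n * R) := mul_le_mul_of_nonneg_left hs hθ0
        _ = θ ^ (n + 1) * R := by ring
  rw [← hcl.closure_eq, Metric.mem_closure_iff]
  intro ε hε
  have hlim : Filter.Tendsto (fun n : ℕ => θ ^ n * R) Filter.atTop (nhds 0) := by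
    simpa using (tendsto_pow_atTop_nhds_zero_of_lt_one hθ0 hθ1).mul_const R
  obtain ⟨n, hn⟩ := (hlim.eventually (gt_mem_nhds (by positivity : (0:ℝ) < ε ^ 2))).exists
  obtain ⟨s, hs, hle⟩ := happrox n y
  refine ⟨s, hs, ?_⟩
  have h := (le_lyapunov hABr hBr (y 0 - s 0) (y 1 - s 1)).trans_lt (hle.trans_lt hn)
  rw [dist_pi_lt_iff hε]
  intro k
  rw [Real.dist_eq]
  apply abs_lt_of_sq_lt_sq _ hε.le
  fin_cases k
  · simp only [Fin.zero_eta]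
    nlinarith [sq_nonneg (y 1 - s 1)]
  · simp only [Fin.mk_one]
    nlinarith [sq_nonneg (y 0 - s 0)]

theorem interior_inter_eq_empty_of_volume {S S' : Set Pt}
    (h : MeasureTheory.volume (S ∩ S') = 0) : interior S ∩ interior S' = ∅ :=
  (isOpen_interior.inter isOpen_interior).eq_empty_of_measure_zero <|
    MeasureTheory.measure_mono_null (inter_subset_inter interior_subset interior_subset) h

theorem stmt_3 (A B : ℤ) (hAB : |A| ≤ B) (hB : 2 ≤ B)
    (T : Set Pt) (hTne : T.Nonempty) (hTc : IsCompact T) (hT : CrysEq A B T) :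
    (⋃ γ ∈ {γ : Pt → Pt | IsP2 γ}, γ '' T) = Set.univ ∧
    ∀ γ γ' : Pt → Pt, IsP2 γ → IsP2 γ' → γ ≠ γ' →
      interior (γ '' T) ∩ interior (γ' '' T) = ∅ := by
  have hU := hT.centredEq hB
  have hUc : IsCompact (T ∪ -T) := hTc.union hTc.neg
  refine ⟨eq_univ_of_forall fun y => ?_, ?_⟩
  · obtain ⟨u, hu, p, q, h⟩ := hU.exists_add_eq hAB hB hUc (hTne.mono subset_union_left) y
    simp only [mem_iUnion, mem_ofPred_eq, exists_prop]
    rcases hu with hu | hu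
    · exact ⟨_, ⟨1, p, q, Or.inl rfl, rfl⟩, u, hu, by simpa using h⟩
    · exact ⟨_, ⟨-1, p, q, Or.inr rfl, rfl⟩, -u, hu, by simpa using h⟩
  · rintro _ _ ⟨ε, p, q, hε, rfl⟩ ⟨ε', p', q', hε', rfl⟩ hne
    apply interior_inter_eq_empty_of_volume
    have hmem : ∀ ε : ℝ, ε = 1 ∨ ε = -1 → ∀ x ∈ T, ε • x ∈ T ∪ -T := by
      rintro ε (rfl | rfl) x hx
      · exact Or.inl (by simpa using hx)
      · exact Or.inr (by simpa using hx)
    by_cases hpq : p = p' ∧ q = q'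
    · obtain ⟨rfl, rfl⟩ := hpq
      have hεε : ε ≠ ε' := by
        rintro rfl
        exact hne rfl
      have hnull := hT.volume_inter_neg hB hTc
      rw [← volume_image_add_right _ ![(p:ℝ), (q:ℝ)]] at hnull
      refine MeasureTheory.measure_mono_null ?_ hnull
      rintro _ ⟨⟨x, hx, rfl⟩, ⟨x', hx', h⟩⟩
      have h' : ε' • x' = ε • x := add_right_cancel h
      refine ⟨ε • x, ?_, rfl⟩
      rcases hε with rfl | rfl <;> rcases hε' with rfl | rfl
      · exact absurd rfl hεε
      · refine ⟨by simpa using hx, ?_⟩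
        rw [← h']
        simpa using hx'
      · refine ⟨?_, by simpa using hx⟩
        rw [← h']
        simpa using hx'
      · exact absurd rfl hεε
    · have hnull := hU.volume_inter_translate hAB hB hUc (p := p' - p) (q := q' - q) (by omega)
      rw [← volume_image_add_right _ ![(p:ℝ), (q:ℝ)]] at hnull
      refine MeasureTheory.measure_mono_null ?_ hnull
      rintro _ ⟨⟨x, hx, rfl⟩, ⟨x', hx', h⟩⟩
      refine ⟨ε • x, ⟨hmem ε hε x hx, ?_⟩, rfl⟩
      convert hmem ε' hε' x' hx' using 1
      ext k
      have hk := congrFun h k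
      fin_cases k
      · simp at hk ⊢
        linarith
      · simp at hk ⊢
        linarith
end
end
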